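/- arXiv:1905.11203 — 6 statements merged into one kernel-verified Lean document; each statement's English description precedes it below -/
import Mathlib

section
/- Let G be a parallelogram with center z and spanning vectors v, w, with sides a, b, c, d, and let A, B, C, D ∈ ℝ² be such that C − A is a scalar multiple of v, A ∈ a, B ∈ b, C ∈ c, and D ∈ d (i.e., the quadrilateral ABCD and the parallelogram G form a conjugate pair). Then the area of G equals twice the area of convexHull ℝ {A, B, C, D}. -/
open MeasureTheory

/-- The parallelogram with center `z` and spanning vectors `v`, `w`:
the set `{z + s•v + t•w : s, t ∈ [−1, 1]}`. -/
def Pgram (z v w : ℝ × ℝ) : Set (ℝ × ℝ) :=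
  {x | ∃ s t : ℝ, s ∈ Set.Icc (-1 : ℝ) 1 ∧ t ∈ Set.Icc (-1 : ℝ) 1 ∧ x = z + s • v + t • w}

/-- Side `a` of the parallelogram. -/
def sideA (z v w : ℝ × ℝ) : Set (ℝ × ℝ) := segment ℝ (z - v - w) (z - v + w)

/-- Side `b` of the parallelogram. -/
def sideB (z v w : ℝ × ℝ) : Set (ℝ × ℝ) := segment ℝ (z - v + w) (z + v + w)

/-- Side `c` of the parallelogram. -/
def sideC (z v w : ℝ × ℝ) : Set (ℝ × ℝ) := segment ℝ (z + v - w) (z + v + w)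

/-- Side `d` of the parallelogram. -/
def sideD (z v w : ℝ × ℝ) : Set (ℝ × ℝ) := segment ℝ (z - v - w) (z + v - w)

/-- The linear map sending the standard basis to `p, q`. -/
noncomputable def pairMap (p q : ℝ × ℝ) : (ℝ × ℝ) →ₗ[ℝ] (ℝ × ℝ) :=
  (LinearMap.fst ℝ ℝ ℝ).smulRight p + (LinearMap.snd ℝ ℝ ℝ).smulRight q

lemma pairMap_apply (p q x : ℝ × ℝ) : pairMap p q x = x.1 • p + x.2 • q := by
  simp [pairMap]

lemma pairMap_det (p q : ℝ × ℝ) : LinearMap.det (pairMap p q) = p.1 * q.2 - p.2 * q.1 := by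
  rw [← LinearMap.det_toMatrix (Module.Basis.finTwoProd ℝ), Matrix.det_fin_two]
  simp [LinearMap.toMatrix_apply, pairMap_apply]
  ring

lemma volume_affine_image (z p q : ℝ × ℝ) (S : Set (ℝ × ℝ)) :
    volume ((fun x => z + pairMap p q x) '' S)
      = ENNReal.ofReal |p.1 * q.2 - p.2 * q.1| * volume S := by
  have : (fun x => z + pairMap p q x) '' S = (fun x => z + x) '' (pairMap p q '' S) := by
    rw [Set.image_image]
  rw [this, Set.image_add_left, measure_preimage_add, Measure.addHaar_image_linearMap, pairMap_det]

lemma hull4 (A B C D : ℝ × ℝ) : convexHull ℝ ({A, B, C, D} : Set (ℝ × ℝ)) =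
    {x | ∃ a b c d : ℝ, 0 ≤ a ∧ 0 ≤ b ∧ 0 ≤ c ∧ 0 ≤ d ∧ a + b + c + d = 1 ∧
      x = a • A + b • B + c • C + d • D} := by
  apply Set.Subset.antisymm
  · apply convexHull_min
    · rintro x (rfl | rfl | rfl | rfl)
      · exact ⟨1, 0, 0, 0, by simp⟩
      · exact ⟨0, 1, 0, 0, by simp⟩
      · exact ⟨0, 0, 1, 0, by simp⟩
      · exact ⟨0, 0, 0, 1, by simp⟩
    · rintro x ⟨a, b, c, d, ha, hb, hc, hd, h1, rfl⟩ y ⟨a', b', c', d', ha', hb', hc', hd', h1', rfl⟩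
        s t hs ht hst
      refine ⟨s * a + t * a', s * b + t * b', s * c + t * c', s * d + t * d', by positivity,
        by positivity, by positivity, by positivity, ?_, ?_⟩
      · linear_combination s * h1 + t * h1' + hst
      · module
  · rintro x ⟨a, b, c, d, ha, hb, hc, hd, h1, rfl⟩
    have hcv := convex_convexHull ℝ ({A, B, C, D} : Set (ℝ × ℝ))
    have hs := subset_convexHull ℝ ({A, B, C, D} : Set (ℝ × ℝ))
    have := hcv.sum_mem (t := Finset.univ) (w := ![a, b, c, d]) (z := ![A, B, C, D])
      (by intro i _; fin_cases i <;> simpa)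
      (by simp [Fin.sum_univ_four, h1])
      (by intro i _; fin_cases i <;> apply hs <;> simp)
    simpa [Fin.sum_univ_four] using this

lemma hull3 (A B C : ℝ × ℝ) : convexHull ℝ ({A, B, C} : Set (ℝ × ℝ)) =
    {x | ∃ a b c : ℝ, 0 ≤ a ∧ 0 ≤ b ∧ 0 ≤ c ∧ a + b + c = 1 ∧
      x = a • A + b • B + c • C} := by
  have h : ({A, B, C} : Set (ℝ × ℝ)) = {A, B, C, C} := by simp
  rw [h, hull4]
  ext x
  constructor
  · rintro ⟨a, b, c, d, ha, hb, hc, hd, h1, rfl⟩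
    exact ⟨a, b, c + d, ha, hb, by positivity, by linarith, by module⟩
  · rintro ⟨a, b, c, ha, hb, hc, h1, rfl⟩
    exact ⟨a, b, c, 0, ha, hb, hc, le_rfl, by linarith, by module⟩

/-- The standard triangle. -/
def stdTri : Set (ℝ × ℝ) := {x | 0 ≤ x.1 ∧ 0 ≤ x.2 ∧ x.1 + x.2 ≤ 1}

lemma volume_stdTri : volume stdTri = ENNReal.ofReal (1 / 2) := by
  have hm : MeasurableSet stdTri := by
    apply IsClosed.measurableSet
    have h1 : IsClosed {x : ℝ × ℝ | 0 ≤ x.1} := isClosed_le (by fun_prop) (by fun_prop)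
    have h2 : IsClosed {x : ℝ × ℝ | 0 ≤ x.2} := isClosed_le (by fun_prop) (by fun_prop)
    have h3 : IsClosed {x : ℝ × ℝ | x.1 + x.2 ≤ 1} := isClosed_le (by fun_prop) (by fun_prop)
    have h : stdTri = {x : ℝ × ℝ | 0 ≤ x.1} ∩ ({x | 0 ≤ x.2} ∩ {x | x.1 + x.2 ≤ 1}) := by
      ext x; simp [stdTri]
    rw [h]
    exact h1.inter (h2.inter h3)
  rw [Measure.volume_eq_prod, Measure.prod_apply hm]
  have h : ∀ x : ℝ, volume (Prod.mk x ⁻¹' stdTri)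
      = (Set.Icc (0 : ℝ) 1).indicator (fun x => ENNReal.ofReal (1 - x)) x := by
    intro x
    by_cases hx : x ∈ Set.Icc (0 : ℝ) 1
    · rw [Set.indicator_of_mem hx]
      have : Prod.mk x ⁻¹' stdTri = Set.Icc 0 (1 - x) := by
        ext y
        simp only [stdTri, Set.mem_preimage, Set.mem_ofPred_eq, Set.mem_Icc]
        exact ⟨fun h => ⟨h.2.1, by linarith⟩, fun h => ⟨hx.1, h.1, by linarith⟩⟩
      rw [this, Real.volume_Icc, sub_zero]
    · rw [Set.indicator_of_notMem hx]
      have : Prod.mk x ⁻¹' stdTri = ∅ := by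
        ext y
        simp only [stdTri, Set.mem_preimage, Set.mem_ofPred_eq, Set.mem_empty_iff_false, iff_false]
        exact fun h => hx ⟨h.1, by linarith⟩
      rw [this, measure_empty]
  simp_rw [h]
  rw [lintegral_indicator measurableSet_Icc, ← ofReal_integral_eq_lintegral_ofReal]
  · rw [integral_Icc_eq_integral_Ioc, ← intervalIntegral.integral_of_le zero_le_one]
    congr 1
    rw [intervalIntegral.integral_sub (by simp) (by simp), integral_id]
    norm_num
  · exact (by fun_prop : Continuous fun x : ℝ => 1 - x).integrableOn_Icc
  · filter_upwards [ae_restrict_mem measurableSet_Icc] with x hx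
    simpa using hx.2

lemma volume_tri (A B C : ℝ × ℝ) : volume (convexHull ℝ ({A, B, C} : Set (ℝ × ℝ))) =
    ENNReal.ofReal (|(B - A).1 * (C - A).2 - (B - A).2 * (C - A).1| / 2) := by
  have : convexHull ℝ ({A, B, C} : Set (ℝ × ℝ))
      = (fun x => A + pairMap (B - A) (C - A) x) '' stdTri := by
    rw [hull3]
    ext x
    constructor
    · rintro ⟨a, b, c, ha, hb, hc, h1, rfl⟩
      refine ⟨(b, c), ⟨hb, hc, by simp only; linarith⟩, ?_⟩
      obtain rfl : a = 1 - b - c := by linarith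
      simp only [pairMap_apply]
      module
    · rintro ⟨⟨b, c⟩, ⟨hb, hc, h1⟩, rfl⟩
      simp only at hb hc h1
      refine ⟨1 - b - c, b, c, by linarith, hb, hc, by ring, ?_⟩
      simp only [pairMap_apply]
      module
  rw [this, volume_affine_image, volume_stdTri, ← ENNReal.ofReal_mul (abs_nonneg _)]
  congr 1
  ring

lemma hull_split_aux (α β δ a b c d : ℝ) (hα : -1 ≤ α ∧ α ≤ 1) (hβ : -1 ≤ β ∧ β ≤ 1)
    (hδ : -1 ≤ δ ∧ δ ≤ 1) (ha : 0 ≤ a) (hb : 0 ≤ b) (hc : 0 ≤ c) (hd : 0 ≤ d)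
    (h1 : a + b + c + d = 1) (h : d * (1 + α) ≤ b * (1 - α)) :
    ∃ a' c' b' : ℝ, 0 ≤ a' ∧ 0 ≤ c' ∧ 0 ≤ b' ∧ a' + c' + b' = 1 ∧
      -a + b * β + c + d * δ = -a' + c' + b' * β ∧
      a * α + b + c * α - d = a' * α + c' * α + b' := by
  obtain ⟨b', hb0, hbb, hb'⟩ : ∃ b' : ℝ, 0 ≤ b' ∧ b' ≤ b ∧ b' * (1 - α) =
      b * (1 - α) - d * (1 + α) := by
    rcases hα.2.eq_or_lt with rfl | hlt
    · exact ⟨b, hb, le_rfl, by linarith⟩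
    · have hp : 0 < 1 - α := by linarith
      have hp' : 0 ≤ 1 + α := by linarith
      refine ⟨(b * (1 - α) - d * (1 + α)) / (1 - α), div_nonneg (by linarith) hp.le, ?_, ?_⟩
      · rw [div_le_iff₀ hp]
        nlinarith [mul_nonneg hd hp']
      · field_simp
  refine ⟨(1 - b' - (-a + b * β + c + d * δ) + b' * β) / 2,
    (1 - b' + (-a + b * β + c + d * δ) - b' * β) / 2, b', ?_, ?_, hb0, by ring, by ring, ?_⟩
  · nlinarith [mul_nonneg (sub_nonneg.2 hbb) (sub_nonneg.2 hβ.2), mul_nonneg hd (sub_nonneg.2 hδ.2)]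
  · nlinarith [mul_nonneg (sub_nonneg.2 hbb) (sub_nonneg.2 hβ.1), mul_nonneg hd (sub_nonneg.2 hδ.1)]
  · linear_combination α * h1 - hb'

lemma volume_std_quad (α β δ : ℝ) (hα : -1 ≤ α ∧ α ≤ 1) (hβ : -1 ≤ β ∧ β ≤ 1)
    (hδ : -1 ≤ δ ∧ δ ≤ 1) :
    volume (convexHull ℝ ({(-1, α), (β, 1), (1, α), (δ, -1)} : Set (ℝ × ℝ))) = 2 := by
  have hU : convexHull ℝ ({(-1, α), (β, 1), (1, α), (δ, -1)} : Set (ℝ × ℝ)) =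
      convexHull ℝ ({(-1, α), (1, α), (β, 1)} : Set (ℝ × ℝ)) ∪
      convexHull ℝ ({(-1, α), (1, α), (δ, -1)} : Set (ℝ × ℝ)) := by
    apply Set.Subset.antisymm
    · rw [hull4, hull3, hull3]
      rintro x ⟨a, b, c, d, ha, hb, hc, hd, h1, rfl⟩
      rcases le_total (d * (1 + α)) (b * (1 - α)) with h | h
      · left
        obtain ⟨a', c', b', h1, h2, h3, h4, h5, h6⟩ :=
          hull_split_aux α β δ a b c d hα hβ hδ ha hb hc hd h1 h
        refine ⟨a', c', b', h1, h2, h3, h4, ?_⟩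
        ext
        · simp; linarith
        · simp; linarith
      · right
        obtain ⟨a', c', b', h1, h2, h3, h4, h5, h6⟩ :=
          hull_split_aux (-α) δ β a d c b ⟨by linarith, by linarith⟩ hδ hβ ha hd hc hb
            (by linarith) (by linarith)
        refine ⟨a', c', b', h1, h2, h3, h4, ?_⟩
        ext
        · simp; linarith
        · simp; linarith
    · apply Set.union_subset <;> apply convexHull_mono <;> intro x <;> simp <;> tauto
  have hnull : volume ({x : ℝ × ℝ | x.2 = α}) = 0 := by
    have : {x : ℝ × ℝ | x.2 = α} = Set.univ ×ˢ {α} := by ext; simp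
    rw [this, Measure.volume_eq_prod, Measure.prod_prod]
    simp
  rw [hU, measure_union₀, volume_tri, volume_tri, ← ENNReal.ofReal_add (by positivity) (by positivity)]
  · rw [← ENNReal.ofReal_ofNat 2]
    congr 1
    simp
    rw [show (1 + 1 : ℝ) = 2 by norm_num, abs_of_nonneg (by linarith : 0 ≤ 1 - α),
      abs_of_nonpos (by linarith : -1 - α ≤ 0)]
    ring
  · exact ((Set.toFinite _).isCompact_convexHull (𝕜 := ℝ)).isClosed.measurableSet.nullMeasurableSet
  · refine measure_mono_null ?_ hnull
    rw [hull3, hull3]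
    rintro x ⟨⟨a, c, b, ha, hc, hb, h1, h2⟩, ⟨a', c', d, ha', hc', hd, h1', h2'⟩⟩
    have e1 := congrArg Prod.snd h2
    have e2 := congrArg Prod.snd h2'
    simp at e1 e2
    show x.2 = α
    apply le_antisymm
    · rw [e2]; nlinarith [mul_nonneg hd (by linarith : 0 ≤ 1 + α)]
    · rw [e1]; nlinarith [mul_nonneg hb (by linarith : 0 ≤ 1 - α)]

lemma seg_param (p q x : ℝ × ℝ) (h : x ∈ segment ℝ (p - q) (p + q)) :
    ∃ t : ℝ, (-1 ≤ t ∧ t ≤ 1) ∧ x = p + t • q := by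
  obtain ⟨a, b, ha, hb, hab, rfl⟩ := h
  refine ⟨b - a, ⟨by linarith, by linarith⟩, ?_⟩
  obtain rfl : a = 1 - b := by linarith
  module

/-- If the quadrilateral `ABCD` and the parallelogram `G` form a conjugate pair,
then the area of `G` is twice the area of `ABCD`. -/
theorem area_parallelogram_eq_twice_area_conjugate_quadrilateral
    (z v w : ℝ × ℝ) (hvw : LinearIndependent ℝ ![v, w])
    (A B C D : ℝ × ℝ)
    (hAC : ∃ t : ℝ, C - A = t • v)
    (hA : A ∈ sideA z v w) (hB : B ∈ sideB z v w)
    (hC : C ∈ sideC z v w) (hD : D ∈ sideD z v w) :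
    volume (Pgram z v w) = 2 * volume (convexHull ℝ ({A, B, C, D} : Set (ℝ × ℝ))) := by
  obtain ⟨α, hα, rfl⟩ := seg_param (z - v) w A hA
  obtain ⟨γ, hγ, rfl⟩ := seg_param (z + v) w C hC
  obtain ⟨β, hβ, rfl⟩ := seg_param (z + w) v B (by
    rw [sideB] at hB; convert hB using 1; congr 1 <;> abel)
  obtain ⟨δ, hδ, rfl⟩ := seg_param (z - w) v D (by
    rw [sideD] at hD; convert hD using 1; congr 1 <;> abel)
  obtain ⟨t, ht⟩ := hAC
  have hγα : γ - α = 0 := by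
    refine (LinearIndependent.pair_iff.1 hvw (2 - t) (γ - α) ?_).2
    rw [sub_smul, ← ht]
    module
  obtain rfl : γ = α := by linarith
  have hG : Pgram z v w = (fun x => z + pairMap v w x) '' (Set.Icc (-1) 1 ×ˢ Set.Icc (-1) 1) := by
    ext x
    constructor
    · rintro ⟨s, t, hs, ht, rfl⟩
      exact ⟨(s, t), ⟨hs, ht⟩, by simp [pairMap_apply, add_assoc]⟩
    · rintro ⟨⟨s, t⟩, ⟨hs, ht⟩, rfl⟩
      exact ⟨s, t, hs, ht, by simp [pairMap_apply, add_assoc]⟩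
  have hQ : convexHull ℝ ({z - v + γ • w, z + w + β • v, z + v + γ • w, z - w + δ • v} :
      Set (ℝ × ℝ)) = (fun x => z + pairMap v w x) ''
        convexHull ℝ ({(-1, γ), (β, 1), (1, γ), (δ, -1)} : Set (ℝ × ℝ)) := by
    rw [hull4, hull4]
    ext x
    constructor
    · rintro ⟨a, b, c, d, ha, hb, hc, hd, h1, rfl⟩
      refine ⟨_, ⟨a, b, c, d, ha, hb, hc, hd, h1, rfl⟩, ?_⟩
      obtain rfl : a = 1 - b - c - d := by linarith
      simp [pairMap_apply]
      module
    · rintro ⟨_, ⟨a, b, c, d, ha, hb, hc, hd, h1, rfl⟩, rfl⟩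
      refine ⟨a, b, c, d, ha, hb, hc, hd, h1, ?_⟩
      obtain rfl : a = 1 - b - c - d := by linarith
      simp [pairMap_apply]
      module
  rw [hG, hQ, volume_affine_image, volume_affine_image, volume_std_quad γ β δ hα hβ hδ,
    Measure.volume_eq_prod, Measure.prod_prod, Real.volume_Icc,
    show (1 - -1 : ℝ) = 2 by norm_num, ENNReal.ofReal_ofNat]
  ring
end

section
/- Let u ∈ ℝ² be a nonzero vector, let P ⊆ ℝ² be a convex set, let G be a parallelogram with center z and spanning vectors v, w that is S-anchored to u and satisfies P ⊆ G, and let A, B, C, D ∈ P be such that C − A is a scalar multiple of u, A ∈ a, B ∈ b, C ∈ c, D ∈ d (so ABCD and G form a conjugate pair sandwiching P). Then every parallelogram G' that is S-anchored to u and satisfies P ⊆ G' has area at least the area of G. -/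
open MeasureTheory

/-- The linear map sending the unit vectors to `v` and `w`. -/
noncomputable def spanMap (v w : ℝ × ℝ) : (ℝ × ℝ) →ₗ[ℝ] (ℝ × ℝ) :=
  (LinearMap.fst ℝ ℝ ℝ).smulRight v + (LinearMap.snd ℝ ℝ ℝ).smulRight w

theorem spanMap_det (v w : ℝ × ℝ) : LinearMap.det (spanMap v w) = v.1 * w.2 - v.2 * w.1 := by
  rw [← LinearMap.det_toMatrix (Module.Basis.finTwoProd ℝ), Matrix.det_fin_two]
  simp [LinearMap.toMatrix_apply, spanMap]
  ring

theorem pgram_eq (z v w : ℝ × ℝ) :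
    Pgram z v w = (fun x => z + x) '' (spanMap v w '' Set.Icc ((-1 : ℝ), (-1 : ℝ)) (1, 1)) := by
  ext x
  simp only [Pgram, Set.mem_ofPred_eq, Set.mem_image]
  constructor
  · rintro ⟨s, t, hs, ht, rfl⟩
    exact ⟨_, ⟨(s, t), ⟨⟨hs.1, ht.1⟩, ⟨hs.2, ht.2⟩⟩, rfl⟩, by simp [spanMap, add_assoc]⟩
  · rintro ⟨_, ⟨⟨s, t⟩, ⟨⟨h1, h2⟩, ⟨h3, h4⟩⟩, rfl⟩, rfl⟩
    exact ⟨s, t, ⟨h1, h3⟩, ⟨h2, h4⟩, by simp [spanMap, add_assoc]⟩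

theorem pgram_volume (z v w : ℝ × ℝ) :
    volume (Pgram z v w) = ENNReal.ofReal |v.1 * w.2 - v.2 * w.1| *
      volume (Set.Icc ((-1 : ℝ), (-1 : ℝ)) (1, 1)) := by
  rw [pgram_eq, Set.image_add_left, measure_preimage_add, Measure.addHaar_image_linearMap,
    spanMap_det]

theorem det_ne_zero_of_indep (v w : ℝ × ℝ) (h : LinearIndependent ℝ ![v, w]) :
    v.1 * w.2 - v.2 * w.1 ≠ 0 := by
  intro h0
  rw [LinearIndependent.pair_iff] at h
  have h1 := h w.2 (-v.2) (by ext <;> simp <;> linarith)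
  have h2 := h w.1 (-v.1) (by ext <;> simp <;> linarith)
  have h3 := h 0 1 (by ext <;> simp <;> linarith [h1.1, h2.1])
  exact one_ne_zero h3.2

/-- If a conjugate pair `(ABCD, G)` anchored to `u` sandwiches a convex set `P`,
then `G` is a smallest S-anchored parallelogram enclosing `P`. -/
theorem conjugate_pair_gives_smallest_anchored_parallelogram
    (u : ℝ × ℝ) (hu : u ≠ 0) (P : Set (ℝ × ℝ)) (hP : Convex ℝ P)
    (z v w : ℝ × ℝ) (hvw : LinearIndependent ℝ ![v, w])
    (hanch : ∃ r : ℝ, r ≠ 0 ∧ v = r • u)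
    (hPG : P ⊆ Pgram z v w)
    (A B C D : ℝ × ℝ)
    (hAP : A ∈ P) (hBP : B ∈ P) (hCP : C ∈ P) (hDP : D ∈ P)
    (hAC : ∃ t : ℝ, C - A = t • u)
    (hA : A ∈ sideA z v w) (hB : B ∈ sideB z v w)
    (hC : C ∈ sideC z v w) (hD : D ∈ sideD z v w) :
    ∀ z' v' w' : ℝ × ℝ, LinearIndependent ℝ ![v', w'] →
      (∃ r : ℝ, r ≠ 0 ∧ v' = r • u) → P ⊆ Pgram z' v' w' →
      volume (Pgram z v w) ≤ volume (Pgram z' v' w') := by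
  intro z' v' w' hvw' hanch' hPG'
  obtain ⟨r, hr, rfl⟩ := hanch
  obtain ⟨r', hr', rfl⟩ := hanch'
  have d0 := det_ne_zero_of_indep _ _ hvw
  have d0' := det_ne_zero_of_indep _ _ hvw'
  rw [pgram_volume, pgram_volume]
  refine mul_le_mul_left (ENNReal.ofReal_le_ofReal ?_) _
  obtain ⟨sA, tA, ⟨sA1, sA2⟩, -, eA⟩ := hPG' hAP
  obtain ⟨sC, tC, ⟨sC1, sC2⟩, -, eC⟩ := hPG' hCP
  obtain ⟨sB, tB, -, ⟨tB1, tB2⟩, eB⟩ := hPG' hBP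
  obtain ⟨sD, tD, -, ⟨tD1, tD2⟩, eD⟩ := hPG' hDP
  obtain ⟨t, ht⟩ := hAC
  obtain ⟨a1, a2, -, -, ha, fA⟩ := hA
  obtain ⟨b1, b2, -, -, hb, fB⟩ := hB
  obtain ⟨c1, c2, -, -, hc, fC⟩ := hC
  obtain ⟨e1, e2, -, -, he, fD⟩ := hD
  obtain rfl : a1 = 1 - a2 := by linarith
  obtain rfl : b1 = 1 - b2 := by linarith
  obtain rfl : c1 = 1 - c2 := by linarith
  obtain rfl : e1 = 1 - e2 := by linarith
  obtain ⟨u1, u2⟩ := u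
  obtain ⟨w1, w2⟩ := w
  obtain ⟨x1, x2⟩ := w'
  obtain ⟨z1, z2⟩ := z
  obtain ⟨y1, y2⟩ := z'
  obtain ⟨A1, A2⟩ := A
  obtain ⟨B1, B2⟩ := B
  obtain ⟨C1, C2⟩ := C
  obtain ⟨D1, D2⟩ := D
  simp only [Prod.smul_mk, Prod.mk_add_mk, Prod.mk_sub_mk, Prod.mk.injEq, smul_eq_mul] at *
  obtain ⟨eA1, eA2⟩ := eA
  obtain ⟨eB1, eB2⟩ := eB
  obtain ⟨eC1, eC2⟩ := eC
  obtain ⟨eD1, eD2⟩ := eD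
  obtain ⟨fA1, fA2⟩ := fA
  obtain ⟨fB1, fB2⟩ := fB
  obtain ⟨fC1, fC2⟩ := fC
  obtain ⟨fD1, fD2⟩ := fD
  obtain ⟨ht1, ht2⟩ := ht
  have g : u1 * w2 - u2 * w1 ≠ 0 := fun h => d0 (by linear_combination r * h)
  have g' : u1 * x2 - u2 * x1 ≠ 0 := fun h => d0' (by linear_combination r' * h)
  -- the chord AC equals 2v
  have k1 : t = 2 * r := by
    have k0 : c2 = a2 := by
      have : (c2 - a2) * (u1 * w2 - u2 * w1) = 0 := by
        linear_combination (1/2) * (u1 * (ht2 + fC2 - fA2) - u2 * (ht1 + fC1 - fA1))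
      rcases mul_eq_zero.1 this with h | h
      · linarith
      · exact absurd h g
    subst k0
    apply mul_right_cancel₀ g
    linear_combination w1 * (ht2 + fC2 - fA2) - w2 * (ht1 + fC1 - fA1)
  have k2 : t = (sC - sA) * r' := by
    apply mul_right_cancel₀ g'
    linear_combination x1 * (ht2 - eC2 + eA2) - x2 * (ht1 - eC1 + eA1)
  have k3 : 2 * (u1 * w2 - u2 * w1) = (tB - tD) * (u1 * x2 - u2 * x1) := by
    linear_combination u1 * (fB2 - fD2 + eB2 - eD2) - u2 * (fB1 - fD1 + eB1 - eD1)
  have m1 : |r| ≤ |r'| := by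
    have : 2 * |r| = |sC - sA| * |r'| := by
      rw [← abs_mul, ← k2, k1, abs_mul]; norm_num
    have h2 : |sC - sA| ≤ 2 := abs_le.2 ⟨by linarith, by linarith⟩
    linarith [mul_le_mul_of_nonneg_right h2 (abs_nonneg r')]
  have m2 : |u1 * w2 - u2 * w1| ≤ |u1 * x2 - u2 * x1| := by
    have : 2 * |u1 * w2 - u2 * w1| = |tB - tD| * |u1 * x2 - u2 * x1| := by
      rw [← abs_mul, ← k3, abs_mul]; norm_num
    have h2 : |tB - tD| ≤ 2 := abs_le.2 ⟨by linarith, by linarith⟩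
    linarith [mul_le_mul_of_nonneg_right h2 (abs_nonneg (u1 * x2 - u2 * x1))]
  have n1 : r * u1 * w2 - r * u2 * w1 = r * (u1 * w2 - u2 * w1) := by ring
  have n2 : r' * u1 * x2 - r' * u2 * x1 = r' * (u1 * x2 - u2 * x1) := by ring
  rw [n1, n2, abs_mul, abs_mul]
  exact mul_le_mul m1 m2 (abs_nonneg _) (abs_nonneg _)
end

section
/- Let P ⊆ ℝ² be a compact convex set with nonempty interior and let u ∈ ℝ² be nonzero. Then there exist points A, C ∈ P, a real number t > 0, and a nonzero linear functional f : ℝ² → ℝ such that C − A = t • u, f(A) = min over P of f, and f(C) = max over P of f. (That is, for every direction there is an antipodal pair of P parallel to that direction.) -/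
/-- For every nonzero direction `u` and every compact convex set `P ⊆ ℝ²`
with nonempty interior, there is an antipodal pair of `P` parallel to `u`: points
`A, C ∈ P` with `C − A = t • u` for some `t > 0`, together with a nonzero linear
functional attaining its minimum over `P` at `A` and its maximum over `P` at `C`. -/
theorem exists_antipodal_pair_parallel_to_direction
    (P : Set (ℝ × ℝ)) (hPc : IsCompact P) (hPconv : Convex ℝ P)
    (hint : (interior P).Nonempty)
    (u : ℝ × ℝ) (hu : u ≠ 0) :
    ∃ (A C : ℝ × ℝ) (t : ℝ) (f : (ℝ × ℝ) →ₗ[ℝ] ℝ),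
      A ∈ P ∧ C ∈ P ∧ 0 < t ∧ C - A = t • u ∧ f ≠ 0 ∧
      (∀ x ∈ P, f A ≤ f x) ∧ (∀ x ∈ P, f x ≤ f C) := by
  obtain ⟨p, hp⟩ := hint
  have hpP := interior_subset hp
  let D : Set (ℝ × ℝ) := Set.image2 (fun x y => x - y) P P
  have hDdef : D = (fun q : (ℝ × ℝ) × (ℝ × ℝ) => q.1 - q.2) '' (P ×ˢ P) := by
    exact (Set.image_prod _).symm
  have hDc : IsCompact D := by
    rw [hDdef]
    exact (hPc.prod hPc).image (by fun_prop)
  have hDconv : Convex ℝ D := by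
    rintro _ ⟨a, ha, b, hb, rfl⟩ _ ⟨c, hc, d, hd, rfl⟩ r s hr hs hrs
    refine ⟨r • a + s • c, hPconv ha hc hr hs hrs, r • b + s • d, hPconv hb hd hr hs hrs, ?_⟩
    simp only [smul_sub]
    abel
  have hev : ∀ᶠ z in nhds (0 : ℝ × ℝ), z ∈ D := by
    have hc : Filter.Tendsto (fun z : ℝ × ℝ => p + z) (nhds 0) (nhds p) := by
      have : Continuous (fun z : ℝ × ℝ => p + z) := by fun_prop
      simpa using this.tendsto 0
    filter_upwards [hc (mem_interior_iff_mem_nhds.mp hp)] with z hz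
    exact ⟨p + z, hz, p, hpP, by simp⟩
  have h0 : (0 : ℝ × ℝ) ∈ interior D := mem_interior_iff_mem_nhds.mpr hev
  have hTc : IsCompact {t : ℝ | t • u ∈ D} :=
    (isClosedEmbedding_smul_left hu).isCompact_preimage hDc
  obtain ⟨t, ht, hmax⟩ := hTc.exists_isMaxOn
    ⟨0, by simpa using interior_subset h0⟩ (continuous_id.continuousOn)
  have hmax' : ∀ s : ℝ, s • u ∈ D → s ≤ t := fun s hs => hmax hs
  have key : ∀ r : ℝ, r • u ∈ interior D → ∃ s, r < s ∧ s • u ∈ D := by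
    intro r hr
    have hc : Continuous (fun s : ℝ => s • u) := by fun_prop
    have h1 : ∀ᶠ s in nhds r, s • u ∈ D :=
      hc.continuousAt (mem_interior_iff_mem_nhds.mp hr)
    have h2 : ∀ᶠ s in nhdsWithin r (Set.Ioi r), s • u ∈ D :=
      h1.filter_mono nhdsWithin_le_nhds
    obtain ⟨s, hs, hs'⟩ := (h2.and self_mem_nhdsWithin).exists
    exact ⟨s, hs', hs⟩
  have htpos : 0 < t := by
    obtain ⟨s, hs, hsD⟩ := key 0 (by simpa using h0)
    exact hs.trans_le (hmax' s hsD)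
  have hnot : t • u ∉ interior D := by
    intro h
    obtain ⟨s, hs, hsD⟩ := key t h
    exact absurd (hmax' s hsD) (not_le.mpr hs)
  obtain ⟨f, hf⟩ := geometric_hahn_banach_open_point hDconv.interior isOpen_interior hnot
  have hfD : ∀ z ∈ D, f z ≤ f (t • u) := by
    intro z hz
    have hz' : z ∈ closure (interior D) := by
      rw [hDconv.closure_interior_eq_closure_of_nonempty_interior ⟨0, h0⟩]
      exact subset_closure hz
    have hcl : IsClosed {z | f z ≤ f (t • u)} := isClosed_le f.continuous continuous_const
    exact closure_minimal (fun y hy => (hf y hy).le) hcl hz'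
  obtain ⟨C, hC, A, hA, hCA⟩ := ht
  have hCA' : C - A = t • u := hCA
  refine ⟨A, C, t, f.toLinearMap, hA, hC, htpos, hCA', ?_, ?_, ?_⟩
  · intro h
    have h1 := hf 0 h0
    have h2 : f (t • u) = 0 := LinearMap.congr_fun h (t • u)
    rw [h2, map_zero] at h1
    exact lt_irrefl _ h1
  · intro x hx
    have := hfD (C - x) ⟨C, hC, x, hx, rfl⟩
    rw [← hCA', map_sub, map_sub] at this
    show f A ≤ f x
    linarith
  · intro x hx
    have := hfD (x - A) ⟨x, hx, A, hA, rfl⟩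
    rw [← hCA', map_sub, map_sub] at this
    show f x ≤ f C
    linarith
end

section
/- Let P ⊆ ℝ² be a compact convex set with nonempty interior, let u ∈ ℝ² be nonzero, and let A, C ∈ P with C − A = t • u for some t ≥ 0 be such that ‖C − A‖ ≥ ‖C' − A'‖ for all A', C' ∈ P with C' − A' a scalar multiple of u (i.e., AC is a longest chord of P parallel to u). Then A and C form an antipodal pair: there exists a nonzero linear functional f : ℝ² → ℝ with f(A) = min over P of f and f(C) = max over P of f. -/
open scoped Pointwise

/-- A longest chord of a compact convex set `P ⊆ ℝ²` (with nonempty interior)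
parallel to a nonzero direction `u` is an antipodal pair: there is a nonzero linear
functional attaining its minimum over `P` at `A` and its maximum over `P` at `C`. -/
theorem longest_chord_is_antipodal
    (P : Set (ℝ × ℝ)) (hPc : IsCompact P) (hPconv : Convex ℝ P)
    (hint : (interior P).Nonempty)
    (u : ℝ × ℝ) (hu : u ≠ 0)
    (A C : ℝ × ℝ) (hAP : A ∈ P) (hCP : C ∈ P)
    (t : ℝ) (ht : 0 ≤ t) (hAC : C - A = t • u)
    (hlongest : ∀ A' C' : ℝ × ℝ, A' ∈ P → C' ∈ P → (∃ s : ℝ, C' - A' = s • u) →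
      ‖C' - A'‖ ≤ ‖C - A‖) :
    ∃ f : (ℝ × ℝ) →ₗ[ℝ] ℝ, f ≠ 0 ∧ (∀ x ∈ P, f A ≤ f x) ∧ (∀ x ∈ P, f x ≤ f C) := by
  have hnot : C - A ∉ interior (P - P) := by
    intro h
    have hcont : Filter.Tendsto (fun e : ℝ => (t + e) • u) (nhdsWithin 0 (Set.Ioi 0))
        (nhds (C - A)) := by
      have : Continuous (fun e : ℝ => (t + e) • u) := by fun_prop
      have h0 := this.tendsto 0
      simp only [add_zero, ← hAC] at h0
      exact h0.mono_left nhdsWithin_le_nhds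
    have hev := hcont.eventually (mem_interior_iff_mem_nhds.1 h)
    obtain ⟨e, he, hpos⟩ := (hev.and self_mem_nhdsWithin).exists
    obtain ⟨x, hx, y, hy, hxy⟩ := Set.mem_sub.1 he
    have hpos' : 0 < e := hpos
    have hn := hlongest y x hy hx ⟨t + e, hxy⟩
    rw [hxy, hAC, norm_smul, norm_smul, Real.norm_of_nonneg ht,
      Real.norm_of_nonneg (by linarith)] at hn
    have := le_of_mul_le_mul_right hn (norm_pos_iff.2 hu)
    linarith
  have hconv : Convex ℝ (P - P) := hPconv.sub hPconv
  have hne : (interior (P - P)).Nonempty := by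
    obtain ⟨x, hx⟩ := hint
    have hsub : interior P - P ⊆ interior (P - P) :=
      interior_maximal (Set.sub_subset_sub_right interior_subset) isOpen_interior.sub_right
    exact ⟨x - A, hsub (Set.sub_mem_sub hx hAP)⟩
  obtain ⟨f, hf, hle⟩ := geometric_hahn_banach_of_nonempty_interior_point hconv hnot hne
  refine ⟨f.toLinearMap, ?_, fun x hx => ?_, fun x hx => ?_⟩
  · intro h0
    apply hf
    ext x <;> simp [← ContinuousLinearMap.coe_coe, h0]
  · have := hle _ (Set.sub_mem_sub hCP hx)
    simp only [map_sub] at this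
    simp only [ContinuousLinearMap.coe_coe]
    linarith
  · have := hle _ (Set.sub_mem_sub hx hAP)
    simp only [map_sub] at this
    simp only [ContinuousLinearMap.coe_coe]
    linarith
end

section
/- Let P ⊆ ℝ² be a compact convex set with nonempty interior. Then there exists a parallelogram G with P ⊆ G such that every parallelogram G' with P ⊆ G' has area at least the area of G. (A smallest parallelogram enclosing P exists.) -/
open MeasureTheory

/-- Linear map with columns `v`, `w`. -/
noncomputable def colMap (v w : ℝ × ℝ) : (ℝ × ℝ) →ₗ[ℝ] (ℝ × ℝ) :=
  Matrix.toLin (Module.Basis.finTwoProd ℝ) (Module.Basis.finTwoProd ℝ) !![v.1, w.1; v.2, w.2]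

lemma Pgram_volume (z v w : ℝ × ℝ) :
    volume (Pgram z v w) = ENNReal.ofReal |v.1 * w.2 - w.1 * v.2| *
      volume (Set.Icc (-1 : ℝ) 1 ×ˢ Set.Icc (-1 : ℝ) 1) := by
  have h : Pgram z v w = (fun x => z + x) '' (colMap v w '' (Set.Icc (-1 : ℝ) 1 ×ˢ Set.Icc (-1 : ℝ) 1)) := by
    ext x
    simp only [Pgram, Set.mem_setOf_eq, Set.mem_image, Set.mem_prod, Prod.exists]
    constructor
    · rintro ⟨s, t, hs, ht, rfl⟩
      refine ⟨_, _, ⟨s, t, ⟨hs, ht⟩, rfl⟩, ?_⟩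
      simp only [colMap, Matrix.toLin_finTwoProd_apply]
      ext <;> simp <;> ring
    · rintro ⟨p, q, ⟨s, t, ⟨hs, ht⟩, hpq⟩, rfl⟩
      refine ⟨s, t, hs, ht, ?_⟩
      rw [← hpq]
      simp only [colMap, Matrix.toLin_finTwoProd_apply]
      ext <;> simp <;> ring
  rw [h, Set.image_add_left, measure_preimage_add, Measure.addHaar_image_linearMap]
  simp [colMap, LinearMap.det_toLin, Matrix.det_fin_two]

lemma det_ne_of_li (v w : ℝ × ℝ) (h : LinearIndependent ℝ ![v, w]) :
    v.1 * w.2 - w.1 * v.2 ≠ 0 := by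
  rw [LinearIndependent.pair_iff] at h
  intro hd
  have h1 := h w.2 (-v.2) (by ext <;> simp <;> linarith)
  have h2 := h w.1 (-v.1) (by ext <;> simp <;> linarith)
  have h3 := h 1 0 (by ext <;> simp <;> linarith)
  exact one_ne_zero h3.1

lemma li_of_det_ne (v w : ℝ × ℝ) (hd : v.1 * w.2 - w.1 * v.2 ≠ 0) :
    LinearIndependent ℝ ![v, w] := by
  rw [LinearIndependent.pair_iff]
  intro s t h
  have h1 : s * v.1 + t * w.1 = 0 := by simpa using congrArg Prod.fst h
  have h2 : s * v.2 + t * w.2 = 0 := by simpa using congrArg Prod.snd h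
  constructor
  · apply (mul_eq_zero.1 (_ : s * (v.1 * w.2 - w.1 * v.2) = 0)).resolve_right hd
    linear_combination w.2 * h1 - w.1 * h2
  · apply (mul_eq_zero.1 (_ : t * (v.1 * w.2 - w.1 * v.2) = 0)).resolve_right hd
    linear_combination v.1 * h2 - v.2 * h1

/-- The set of strips `|p x + q y - a| ≤ 1` containing `P`. -/
def stripSet (P : Set (ℝ × ℝ)) : Set (ℝ × ℝ × ℝ) :=
  {k | ∀ x ∈ P, |k.1 * x.1 + k.2.1 * x.2 - k.2.2| ≤ 1}

lemma stripSet_compact (P : Set (ℝ × ℝ)) (hint : (interior P).Nonempty) :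
    IsCompact (stripSet P) := by
  obtain ⟨c, hc⟩ := hint
  obtain ⟨r, hr, hb⟩ := Metric.nhds_basis_closedBall.mem_iff.1 (mem_interior_iff_mem_nhds.1 hc)
  have hcl : IsClosed (stripSet P) := by
    have : stripSet P = ⋂ x ∈ P, {k : ℝ × ℝ × ℝ | |k.1 * x.1 + k.2.1 * x.2 - k.2.2| ≤ 1} := by
      ext k; simp [stripSet]
    rw [this]
    refine isClosed_biInter fun x _ => isClosed_le (by fun_prop) (by fun_prop)
  have hmem : ∀ d e : ℝ, |d| ≤ r → |e| ≤ r → (c.1 + d, c.2 + e) ∈ P := by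
    intro d e hd he
    apply hb
    simp [Prod.dist_eq, Real.dist_eq, hd, he]
  set B := 1 / r with hB
  set A := 1 + (B * |c.1| + B * |c.2|) with hA
  refine (isCompact_Icc (a := ((-B, -B, -A) : ℝ × ℝ × ℝ)) (b := (B, B, A))).of_isClosed_subset hcl ?_
  rintro ⟨p, q, a⟩ hk
  have hr' : |r| ≤ r := (abs_of_pos hr).le
  have hnr : |-r| ≤ r := by rw [abs_neg]; exact hr'
  have h0' : |(0:ℝ)| ≤ r := by simpa using hr.le
  have h1 := abs_le.1 (hk _ (hmem r 0 hr' h0'))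
  have h2 := abs_le.1 (hk _ (hmem (-r) 0 hnr h0'))
  have h3 := abs_le.1 (hk _ (hmem 0 r h0' hr'))
  have h4 := abs_le.1 (hk _ (hmem 0 (-r) h0' hnr))
  have h0 := abs_le.1 (hk _ (hmem 0 0 h0' h0'))
  simp only at h0 h1 h2 h3 h4
  have hp : |p| ≤ B := by
    rw [hB, le_div_iff₀ hr, ← abs_of_pos hr, ← abs_mul, abs_le]
    constructor <;> linarith
  have hq : |q| ≤ B := by
    rw [hB, le_div_iff₀ hr, ← abs_of_pos hr, ← abs_mul, abs_le]
    constructor <;> linarith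
  have e1 : |p * c.1| ≤ B * |c.1| := by rw [abs_mul]; gcongr
  have e2 : |q * c.2| ≤ B * |c.2| := by rw [abs_mul]; gcongr
  rw [abs_le] at hp hq e1 e2
  refine ⟨⟨hp.1, hq.1, ?_⟩, ⟨hp.2, hq.2, ?_⟩⟩ <;> simp only <;> linarith

/-- A smallest parallelogram enclosing a compact convex set `P ⊆ ℝ²` with
nonempty interior exists. -/
theorem exists_smallest_enclosing_parallelogram
    (P : Set (ℝ × ℝ)) (hPc : IsCompact P) (hPconv : Convex ℝ P)
    (hint : (interior P).Nonempty) :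
    ∃ z v w : ℝ × ℝ, LinearIndependent ℝ ![v, w] ∧ P ⊆ Pgram z v w ∧
      ∀ z' v' w' : ℝ × ℝ, LinearIndependent ℝ ![v', w'] → P ⊆ Pgram z' v' w' →
        volume (Pgram z v w) ≤ volume (Pgram z' v' w') := by
  have hK := stripSet_compact P hint
  obtain ⟨R, hR, hPR⟩ : ∃ R : ℝ, 0 < R ∧ ∀ x ∈ P, |x.1| ≤ R ∧ |x.2| ≤ R := by
    obtain ⟨R, hR, h⟩ := hPc.isBounded.exists_pos_norm_le
    refine ⟨R, hR, fun x hx => ?_⟩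
    have := h x hx
    rwa [Prod.norm_def, max_le_iff] at this
  have hk1 : ((1 / R, 0, 0) : ℝ × ℝ × ℝ) ∈ stripSet P := by
    intro x hx
    have := (hPR x hx).1
    simp only [zero_mul, add_zero, sub_zero]
    rw [abs_mul, abs_of_pos (by positivity), one_div_mul_eq_div, div_le_one hR]
    exact this
  have hk2 : ((0, 1 / R, 0) : ℝ × ℝ × ℝ) ∈ stripSet P := by
    intro x hx
    have := (hPR x hx).2
    simp only [zero_mul, zero_add, sub_zero]
    rw [abs_mul, abs_of_pos (by positivity), one_div_mul_eq_div, div_le_one hR]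
    exact this
  obtain ⟨⟨⟨p, q, a⟩, ⟨p', q', a'⟩⟩, ⟨hm, hm'⟩, hmax⟩ := (hK.prod hK).exists_isMaxOn
    ⟨(_, _), hk1, hk2⟩
    (f := fun k : (ℝ × ℝ × ℝ) × (ℝ × ℝ × ℝ) => |k.1.1 * k.2.2.1 - k.1.2.1 * k.2.1|)
    (by fun_prop)
  have hmax' : ∀ k l : ℝ × ℝ × ℝ, k ∈ stripSet P → l ∈ stripSet P →
      |k.1 * l.2.1 - k.2.1 * l.1| ≤ |p * q' - q * p'| :=
    fun k l hk hl => hmax (a := (k, l)) ⟨hk, hl⟩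
  have hDpos : 0 < |p * q' - q * p'| := by
    refine lt_of_lt_of_le ?_ (hmax' _ _ hk1 hk2)
    simp only [zero_mul, sub_zero]
    positivity
  clear hmax
  set D := p * q' - q * p' with hD
  have hD0 : D ≠ 0 := abs_pos.1 hDpos
  have hdet : (q' / D) * (p / D) - (-q / D) * (-p' / D) = 1 / D := by
    field_simp
    rw [hD]; ring
  refine ⟨((a * q' - q * a') / D, (p * a' - a * p') / D), (q' / D, -p' / D), (-q / D, p / D),
    li_of_det_ne _ _ ?_, ?_, ?_⟩
  · simp only [hdet]
    exact one_div_ne_zero hD0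
  · intro x hx
    refine ⟨p * x.1 + q * x.2 - a, p' * x.1 + q' * x.2 - a', abs_le.1 (hm x hx),
      abs_le.1 (hm' x hx), ?_⟩
    ext
    · simp only [Prod.fst_add, Prod.smul_fst, smul_eq_mul]
      field_simp
      rw [hD]; ring
    · simp only [Prod.snd_add, Prod.smul_snd, smul_eq_mul]
      field_simp
      rw [hD]; ring
  · intro z v w hli hP
    have hd := det_ne_of_li v w hli
    rw [Pgram_volume, Pgram_volume]
    gcongr ENNReal.ofReal ?_ * _
    simp only [hdet]
    set d := v.1 * w.2 - w.1 * v.2 with hdd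
    have key := hmax' (w.2 / d, -w.1 / d, (w.2 * z.1 - w.1 * z.2) / d)
      (-v.2 / d, v.1 / d, (v.1 * z.2 - v.2 * z.1) / d) ?_ ?_
    · have e : w.2 / d * (v.1 / d) - -w.1 / d * (-v.2 / d) = 1 / d := by
        field_simp
        rw [hdd]; ring
      simp only [e] at key
      rw [abs_div, abs_one] at key ⊢
      rw [div_le_iff₀ (abs_pos.2 hd)] at key
      rw [div_le_iff₀ hDpos]
      linarith
    · intro x hx
      obtain ⟨s, t, hs, ht, rfl⟩ := hP hx
      have : w.2 / d * (z + s • v + t • w).1 + -w.1 / d * (z + s • v + t • w).2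
          - (w.2 * z.1 - w.1 * z.2) / d = s := by
        simp only [Prod.fst_add, Prod.smul_fst, Prod.snd_add, Prod.smul_snd, smul_eq_mul]
        field_simp
        rw [hdd]; ring
      simp only [this]
      exact abs_le.2 hs
    · intro x hx
      obtain ⟨s, t, hs, ht, rfl⟩ := hP hx
      have : -v.2 / d * (z + s • v + t • w).1 + v.1 / d * (z + s • v + t • w).2
          - (v.1 * z.2 - v.2 * z.1) / d = t := by
        simp only [Prod.fst_add, Prod.smul_fst, Prod.snd_add, Prod.smul_snd, smul_eq_mul]
        field_simp
        rw [hdd]; ring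
      simp only [this]
      exact abs_le.2 ht
end

section
/- Let A, B, D, C₀, C₁ ∈ ℝ². Then for every point C in the segment [C₀, C₁], the area of convexHull ℝ {A, B, C, D} is at most the maximum of the area of convexHull ℝ {A, B, C₀, D} and the area of convexHull ℝ {A, B, C₁, D}. (The area of a quadrilateral with one corner moving along a segment attains its maximum at an endpoint of the segment.) -/
open MeasureTheory

lemma aux_decomp (s : Set (ℝ × ℝ)) (hs : s.Nonempty) (C₀ C₁ : ℝ × ℝ) (h : C₀.1 = C₁.1) (a b : ℝ)
    (hab : a + b = 1) (x y : ℝ)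
    (hp : (x, y) ∈ convexHull ℝ (insert (a • C₀ + b • C₁) s)) :
    ∃ y0 y1, (x, y0) ∈ convexHull ℝ (insert C₀ s) ∧ (x, y1) ∈ convexHull ℝ (insert C₁ s) ∧
      y = a * y0 + b * y1 := by
  rw [convexHull_insert hs] at hp
  simp only [convexJoin_singleton_left, Set.mem_iUnion] at hp
  obtain ⟨q, hq, α, β, hα, hβ, hαβ, e⟩ := hp
  have key : ∀ C : ℝ × ℝ, α • C + β • q ∈ convexHull ℝ (insert C s) := fun C =>
    (convex_convexHull ℝ _) (subset_convexHull ℝ _ (Set.mem_insert _ _))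
      (convexHull_mono (Set.subset_insert _ _) hq) hα hβ hαβ
  have e1 := congrArg Prod.fst e
  have e2 := congrArg Prod.snd e
  simp at e1 e2
  refine ⟨α * C₀.2 + β * q.2, α * C₁.2 + β * q.2, ?_, ?_, ?_⟩
  · convert key C₀ using 1
    ext
    · simp
      rw [← e1, ← h]
      linear_combination (α * C₀.1) * hab
    · simp
  · convert key C₁ using 1
    ext
    · simp
      rw [← e1, h]
      linear_combination (α * C₁.1) * hab
    · simp
  · rw [← e2]
    linear_combination (-(β * q.2)) * hab

lemma aux_edist (K : Set (ℝ × ℝ)) (hK : Convex ℝ K) (x y z : ℝ) (hy : (x, y) ∈ K)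
    (hz : (x, z) ∈ K) : ENNReal.ofReal |z - y| ≤ volume (Prod.mk x ⁻¹' K) := by
  rw [← Real.volume_interval]
  apply measure_mono
  have hc : Convex ℝ (Prod.mk x ⁻¹' K) := by
    intro u hu v hv a b ha hb hab
    have := hK hu hv ha hb hab
    have e : (a • (x, u) + b • (x, v) : ℝ × ℝ) = (x, a • u + b • v) := by
      ext
      · simp
        linear_combination x * hab
      · simp
    rw [e] at this
    exact this
  exact hc.ordConnected.uIcc_subset hy hz

lemma aux_slice (s : Set (ℝ × ℝ)) (hs : s.Nonempty) (C₀ C₁ : ℝ × ℝ) (h : C₀.1 = C₁.1) (a b : ℝ)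
    (ha : 0 ≤ a) (hb : 0 ≤ b) (hab : a + b = 1) (x : ℝ) :
    volume (Prod.mk x ⁻¹' (convexHull ℝ (insert (a • C₀ + b • C₁) s))) ≤
      ENNReal.ofReal a * volume (Prod.mk x ⁻¹' (convexHull ℝ (insert C₀ s))) +
      ENNReal.ofReal b * volume (Prod.mk x ⁻¹' (convexHull ℝ (insert C₁ s))) := by
  refine (Real.volume_le_diam _).trans (Metric.ediam_le ?_)
  intro y hy z hz
  obtain ⟨y0, y1, hy0, hy1, rfl⟩ := aux_decomp s hs C₀ C₁ h a b hab x y hy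
  obtain ⟨z0, z1, hz0, hz1, rfl⟩ := aux_decomp s hs C₀ C₁ h a b hab x z hz
  have h0 := aux_edist _ (convex_convexHull ℝ _) x _ _ hz0 hy0
  have h1 := aux_edist _ (convex_convexHull ℝ _) x _ _ hz1 hy1
  calc _ = ENNReal.ofReal |(a * y0 + b * y1) - (a * z0 + b * z1)| := by
        rw [edist_dist, Real.dist_eq]
    _ ≤ ENNReal.ofReal (a * |y0 - z0| + b * |y1 - z1|) := by
        apply ENNReal.ofReal_le_ofReal
        calc _ = |a * (y0 - z0) + b * (y1 - z1)| := by ring_nf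
          _ ≤ _ := (abs_add_le _ _).trans (by rw [abs_mul, abs_mul, abs_of_nonneg ha, abs_of_nonneg hb])
    _ = ENNReal.ofReal a * ENNReal.ofReal |y0 - z0| + ENNReal.ofReal b * ENNReal.ofReal |y1 - z1| := by
        rw [ENNReal.ofReal_add (by positivity) (by positivity), ENNReal.ofReal_mul ha,
          ENNReal.ofReal_mul hb]
    _ ≤ _ := by gcongr

lemma aux_vertical (s : Set (ℝ × ℝ)) (hs : s.Nonempty) (hf : s.Finite) (C₀ C₁ : ℝ × ℝ)
    (h : C₀.1 = C₁.1) (a b : ℝ) (ha : 0 ≤ a) (hb : 0 ≤ b) (hab : a + b = 1) :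
    volume (convexHull ℝ (insert (a • C₀ + b • C₁) s)) ≤
      max (volume (convexHull ℝ (insert C₀ s))) (volume (convexHull ℝ (insert C₁ s))) := by
  have hm : ∀ C : ℝ × ℝ, MeasurableSet (convexHull ℝ (insert C s)) := fun C =>
    ((hf.insert C).isCompact_convexHull ℝ).measurableSet
  have hv : ∀ C : ℝ × ℝ, volume (convexHull ℝ (insert C s)) =
      ∫⁻ x, volume (Prod.mk x ⁻¹' (convexHull ℝ (insert C s))) := fun C => by
    rw [Measure.volume_eq_prod, Measure.prod_apply (hm C)]
  have hab' : ENNReal.ofReal a + ENNReal.ofReal b = 1 := by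
    rw [← ENNReal.ofReal_add ha hb, hab, ENNReal.ofReal_one]
  calc _ ≤ ∫⁻ x, (ENNReal.ofReal a * volume (Prod.mk x ⁻¹' (convexHull ℝ (insert C₀ s))) +
      ENNReal.ofReal b * volume (Prod.mk x ⁻¹' (convexHull ℝ (insert C₁ s)))) := by
        rw [hv]
        exact lintegral_mono fun x => aux_slice s hs C₀ C₁ h a b ha hb hab x
    _ = ENNReal.ofReal a * volume (convexHull ℝ (insert C₀ s)) +
        ENNReal.ofReal b * volume (convexHull ℝ (insert C₁ s)) := by
        rw [lintegral_add_left ((measurable_measure_prodMk_left (hm C₀)).const_mul _),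
          lintegral_const_mul _ (measurable_measure_prodMk_left (hm C₀)),
          lintegral_const_mul _ (measurable_measure_prodMk_left (hm C₁)), ← hv, ← hv]
    _ ≤ ENNReal.ofReal a * max (volume (convexHull ℝ (insert C₀ s))) (volume (convexHull ℝ (insert C₁ s))) +
        ENNReal.ofReal b * max (volume (convexHull ℝ (insert C₀ s))) (volume (convexHull ℝ (insert C₁ s))) := by
        gcongr
        · exact le_max_left _ _
        · exact le_max_right _ _
    _ = _ := by rw [← add_mul, hab', one_mul]

/-- Linear map sending the direction `(p, q)` to the vertical axis. -/
noncomputable def auxMap (p q : ℝ) : (ℝ × ℝ) →ₗ[ℝ] (ℝ × ℝ) :=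
  (q • LinearMap.fst ℝ ℝ ℝ - p • LinearMap.snd ℝ ℝ ℝ).prod
    (p • LinearMap.fst ℝ ℝ ℝ + q • LinearMap.snd ℝ ℝ ℝ)

lemma auxMap_det (p q : ℝ) (h : p ^ 2 + q ^ 2 ≠ 0) : LinearMap.det (auxMap p q) ≠ 0 := by
  have hinj : Function.Injective (auxMap p q) := by
    rw [injective_iff_map_eq_zero]
    rintro ⟨u, v⟩ huv
    simp [auxMap] at huv
    obtain ⟨h1, h2⟩ := huv
    have hu : (p ^ 2 + q ^ 2) * u = 0 := by linear_combination q * h1 + p * h2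
    have hv : (p ^ 2 + q ^ 2) * v = 0 := by linear_combination q * h2 - p * h1
    simp [h] at hu hv
    simp [hu, hv]
  exact (LinearEquiv.isUnit_det' (LinearEquiv.ofInjectiveEndo (auxMap p q) hinj)).ne_zero

/-- As one corner of a quadrilateral moves along a segment, the area of the
quadrilateral is at most the maximum of the areas at the two endpoints of the segment. -/
theorem area_quadrilateral_moving_corner_le_max_of_endpoints
    (A B D C₀ C₁ : ℝ × ℝ) :
    ∀ C ∈ segment ℝ C₀ C₁,
      volume (convexHull ℝ ({A, B, C, D} : Set (ℝ × ℝ))) ≤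
        max (volume (convexHull ℝ ({A, B, C₀, D} : Set (ℝ × ℝ))))
          (volume (convexHull ℝ ({A, B, C₁, D} : Set (ℝ × ℝ)))) := by
  rintro C ⟨a, b, ha, hb, hab, rfl⟩
  have hset : ∀ C : ℝ × ℝ, ({A, B, C, D} : Set (ℝ × ℝ)) = insert C {A, B, D} := by
    intro C
    ext z
    simp only [Set.mem_insert_iff, Set.mem_singleton_iff]
    tauto
  simp only [hset]
  by_cases hd : (C₁.1 - C₀.1) ^ 2 + (C₁.2 - C₀.2) ^ 2 = 0
  · have h1 : C₁.1 - C₀.1 = 0 := by nlinarith [sq_nonneg (C₁.1 - C₀.1), sq_nonneg (C₁.2 - C₀.2)]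
    exact aux_vertical _ (by simp) (by simp) C₀ C₁ (by linarith) a b ha hb hab
  set L := auxMap (C₁.1 - C₀.1) (C₁.2 - C₀.2) with hL
  have hdet : LinearMap.det L ≠ 0 := auxMap_det _ _ hd
  have hvol : ∀ C : ℝ × ℝ, volume (convexHull ℝ (insert (L C) (L '' {A, B, D}))) =
      ENNReal.ofReal |LinearMap.det L| * volume (convexHull ℝ (insert C {A, B, D})) := by
    intro C
    rw [← Set.image_insert_eq, ← L.image_convexHull, Measure.addHaar_image_linearMap]
  have key := aux_vertical (L '' {A, B, D}) (by simp) (Set.Finite.image _ (by simp)) (L C₀) (L C₁)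
    (by simp [hL, auxMap]; ring) a b ha hb hab
  rw [← map_smul, ← map_smul, ← map_add, hvol, hvol, hvol, ← mul_max] at key
  exact (ENNReal.mul_le_mul_iff_right (by simpa using hdet) ENNReal.ofReal_ne_top).1 key
end
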